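/- arXiv:1711.00819 — 15 statements merged into one kernel-verified Lean document; each statement's English description precedes it below -/
import Mathlib

section
/- For every fixed a > 0, the function ν ↦ ν·coth(ν·a) is strictly increasing on the interval (0, ∞), where coth t = cosh t / sinh t for t ≠ 0. -/
theorem stmt_1 (a : ℝ) (ha : 0 < a) :
    StrictMonoOn (fun ν : ℝ => ν * (Real.cosh (ν * a) / Real.sinh (ν * a))) (Set.Ioi 0) := by
  have hd : ∀ x : ℝ, 0 < x → HasDerivAt
      (fun ν : ℝ => ν * (Real.cosh (ν * a) / Real.sinh (ν * a)))
      ((Real.cosh (x * a) * Real.sinh (x * a) - x * a) / Real.sinh (x * a) ^ 2) x := by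
    intro x hx
    have hs : Real.sinh (x * a) ≠ 0 := (Real.sinh_pos_iff.2 (mul_pos hx ha)).ne'
    have hl : HasDerivAt (fun ν : ℝ => ν * a) (1 * a) x := (hasDerivAt_id x).mul_const a
    have h := (hasDerivAt_id x).mul (hl.cosh.div hl.sinh hs)
    refine h.congr_deriv ?_
    have h1 := Real.cosh_sq (x * a)
    simp only [id, Pi.div_apply]
    field_simp
    linear_combination (-x * a) * h1
  apply strictMonoOn_of_deriv_pos (convex_Ioi 0)
  · exact fun x hx => (hd x hx).continuousAt.continuousWithinAt
  · intro x hx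
    rw [interior_Ioi] at hx
    rw [(hd x hx).deriv]
    have hp : 0 < x * a := mul_pos hx ha
    have h1 := Real.self_lt_sinh_iff.2 hp
    have h2 := Real.one_le_cosh (x * a)
    have h3 : 0 < Real.sinh (x * a) := hp.trans h1
    apply div_pos _ (by positivity)
    nlinarith
end

section
/- For every fixed a with 0 < a ≤ 1, there exists a unique ν in the open interval (0, π/2) satisfying the class IV(ii) determining equation tan ν = coth(ν·a), i.e. sin ν · sinh(ν·a) = cos ν · cosh(ν·a). -/
theorem stmt_2 (a : ℝ) (ha : 0 < a) (ha' : a ≤ 1) :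
    ∃! ν : ℝ, ν ∈ Set.Ioo 0 (Real.pi / 2) ∧
      Real.sin ν * Real.sinh (ν * a) = Real.cos ν * Real.cosh (ν * a) := by
  have hpi := Real.pi_pos
  let f : ℝ → ℝ := fun x => Real.sin x * Real.sinh (x * a) - Real.cos x * Real.cosh (x * a)
  have hd : ∀ x, HasDerivAt f ((1 - a) * (Real.cos x * Real.sinh (x * a))
      + (1 + a) * (Real.sin x * Real.cosh (x * a))) x := by
    intro x
    have h1 : HasDerivAt (fun x : ℝ => x * a) a x := by
      simpa using (hasDerivAt_id x).mul_const a
    have h2 := ((Real.hasDerivAt_sin x).mul h1.sinh).sub ((Real.hasDerivAt_cos x).mul h1.cosh)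
    refine HasDerivAt.congr_deriv (f := f) h2 ?_
    ring
  have hc : Continuous f := by fun_prop
  have hm : StrictMonoOn f (Set.Icc 0 (Real.pi / 2)) := by
    apply strictMonoOn_of_deriv_pos (convex_Icc _ _) hc.continuousOn
    intro x hx
    rw [interior_Icc] at hx
    rw [(hd x).deriv]
    have h1 := Real.cos_pos_of_mem_Ioo ⟨by linarith [hx.1], hx.2⟩
    have h2 := Real.sin_pos_of_pos_of_lt_pi hx.1 (by linarith [hx.2])
    have h3 : 0 < Real.sinh (x * a) := Real.sinh_pos_iff.2 (mul_pos hx.1 ha)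
    have h4 := Real.cosh_pos (x * a)
    have h5 : 0 ≤ 1 - a := by linarith
    positivity
  have h0 : f 0 < 0 := by simp [f]
  have h1 : 0 < f (Real.pi / 2) := by
    have : 0 < Real.sinh (Real.pi / 2 * a) := Real.sinh_pos_iff.2 (by positivity)
    simpa [f] using this
  obtain ⟨x, hx, hfx⟩ := intermediate_value_Ioo (by positivity : (0:ℝ) ≤ Real.pi / 2)
    hc.continuousOn ⟨h0, h1⟩
  refine ⟨x, ⟨hx, sub_eq_zero.1 hfx⟩, ?_⟩
  rintro y ⟨hy, hfy⟩
  exact hm.injOn (Set.Ioo_subset_Icc_self hy) (Set.Ioo_subset_Icc_self hx)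
    ((sub_eq_zero.2 hfy : f y = 0).trans hfx.symm)
end

section
/- For every fixed a with 0 < a ≤ 1, the function k_a(ν) = ν·cot ν − ν·tanh(ν·a) is strictly decreasing on the interval (0, π/2); moreover k_a(ν) → 1 as ν → 0⁺ and k_a(ν) → −(π/2)·tanh(π·a/2) as ν → (π/2)⁻. -/
open Real Filter

theorem stmt_3 (a : ℝ) (ha : 0 < a) (ha' : a ≤ 1) :
    StrictAntiOn (fun ν : ℝ => ν * Real.cot ν - ν * Real.tanh (ν * a)) (Set.Ioo 0 (Real.pi / 2)) ∧
    Tendsto (fun ν : ℝ => ν * Real.cot ν - ν * Real.tanh (ν * a)) (nhdsWithin 0 (Set.Ioi 0)) (nhds 1) ∧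
    Tendsto (fun ν : ℝ => ν * Real.cot ν - ν * Real.tanh (ν * a))
      (nhdsWithin (Real.pi / 2) (Set.Iio (Real.pi / 2)))
      (nhds (-(Real.pi / 2) * Real.tanh (Real.pi * a / 2))) := by
  have hder : ∀ x : ℝ, Real.sin x ≠ 0 →
      HasDerivAt (fun ν : ℝ => ν * (Real.cos ν / Real.sin ν)
          - ν * (Real.sinh (ν * a) / Real.cosh (ν * a)))
        ((1 * (Real.cos x / Real.sin x) + x * ((-Real.sin x * Real.sin x - Real.cos x * Real.cos x)
          / Real.sin x ^ 2)) - (1 * (Real.sinh (x * a) / Real.cosh (x * a)) +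
          x * (((Real.cosh (x * a) * (1 * a)) * Real.cosh (x * a) -
            Real.sinh (x * a) * (Real.sinh (x * a) * (1 * a))) / Real.cosh (x * a) ^ 2))) x := by
    intro x hx
    have hl : HasDerivAt (fun ν : ℝ => ν * a) (1 * a) x := (hasDerivAt_id x).mul_const a
    exact ((hasDerivAt_id x).mul ((Real.hasDerivAt_cos x).div (Real.hasDerivAt_sin x) hx)).sub
      ((hasDerivAt_id x).mul ((hl.sinh).div hl.cosh (Real.cosh_pos _).ne'))
  simp only [Real.cot_eq_cos_div_sin, Real.tanh_eq_sinh_div_cosh]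
  refine ⟨?_, ?_, ?_⟩
  · have hs : ∀ x ∈ Set.Ioo 0 (Real.pi / 2), 0 < Real.sin x := fun x hx =>
      Real.sin_pos_of_pos_of_lt_pi hx.1 (by linarith [hx.2, Real.pi_pos])
    refine strictAntiOn_of_deriv_neg (convex_Ioo _ _)
      (fun x hx => (hder x (hs x hx).ne').continuousAt.continuousWithinAt) ?_
    intro x hx
    rw [interior_Ioo] at hx
    have h0 := hs x hx
    rw [(hder x h0.ne').deriv]
    have hc : 0 < Real.cosh (x * a) := Real.cosh_pos _
    have hsh : 0 < Real.sinh (x * a) := Real.sinh_pos_iff.2 (mul_pos hx.1 ha)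
    have e1 : 1 * (Real.cos x / Real.sin x) + x * ((-Real.sin x * Real.sin x - Real.cos x * Real.cos x)
          / Real.sin x ^ 2) = (Real.sin x * Real.cos x - x) / Real.sin x ^ 2 := by
      have := Real.sin_sq_add_cos_sq x
      field_simp
      linear_combination (-x) * this
    have e2 : (Real.cosh (x * a) * (1 * a)) * Real.cosh (x * a) -
            Real.sinh (x * a) * (Real.sinh (x * a) * (1 * a)) = a := by
      linear_combination a * Real.cosh_sq_sub_sinh_sq (x * a)
    rw [e1, e2]
    have h1 : (Real.sin x * Real.cos x - x) / Real.sin x ^ 2 < 0 := by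
      apply div_neg_of_neg_of_pos _ (by positivity)
      nlinarith [Real.sin_lt hx.1, Real.cos_le_one x]
    have h2 : 0 < Real.sinh (x * a) / Real.cosh (x * a) := by positivity
    have h3 : 0 < x * (a / Real.cosh (x * a) ^ 2) := by
      have := hx.1
      positivity
    linarith
  · have hc : ContinuousAt (fun ν : ℝ => Real.cos ν / Real.sinc ν
        - ν * (Real.sinh (ν * a) / Real.cosh (ν * a))) 0 := by
      have h1 : ContinuousAt (fun ν : ℝ => Real.cos ν / Real.sinc ν) 0 :=
        Real.continuous_cos.continuousAt.div Real.continuous_sinc.continuousAt (by simp)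
      have h2 : Continuous (fun ν : ℝ => ν * (Real.sinh (ν * a) / Real.cosh (ν * a))) :=
        continuous_id.mul ((Real.continuous_sinh.comp (by fun_prop)).div
          (Real.continuous_cosh.comp (by fun_prop)) (fun x => (Real.cosh_pos _).ne'))
      exact h1.sub h2.continuousAt
    have ht := hc.tendsto.mono_left (nhdsWithin_le_nhds (s := Set.Ioi 0))
    simp only [Real.cos_zero, Real.sinc_zero, zero_mul, sub_zero, div_one] at ht
    refine ht.congr' ?_
    filter_upwards [self_mem_nhdsWithin] with x hx
    have hx0 : x ≠ 0 := ne_of_gt hx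
    rw [Real.sinc_of_ne_zero hx0, div_div_eq_mul_div]
    ring
  · have ht := (hder (Real.pi / 2) (by simp)).continuousAt.tendsto.mono_left
      (nhdsWithin_le_nhds (s := Set.Iio (Real.pi / 2)))
    convert ht using 2
    rw [Real.cos_pi_div_two, show Real.pi / 2 * a = Real.pi * a / 2 by ring]
    ring
end

section
/- For every fixed a with 0 < a ≤ 1, there exists a unique ν in the open interval (0, π/(2a)) satisfying the class III(i) determining equation tan(ν·a) = coth ν, i.e. sin(ν·a) · sinh ν = cos(ν·a) · cosh ν. -/
theorem stmt_4_aux (a : ℝ) (ha : 0 < a) (x y : ℝ) (hx : x ∈ Set.Ioo 0 (Real.pi / (2 * a)))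
    (hy : y ∈ Set.Ioo 0 (Real.pi / (2 * a)))
    (ex : Real.sin (x * a) * Real.sinh x = Real.cos (x * a) * Real.cosh x)
    (ey : Real.sin (y * a) * Real.sinh y = Real.cos (y * a) * Real.cosh y)
    (hxy : x < y) : False := by
  have key : ∀ z ∈ Set.Ioo 0 (Real.pi / (2 * a)), 0 < z * a ∧ z * a < Real.pi / 2 := by
    intro z hz
    refine ⟨mul_pos hz.1 ha, ?_⟩
    have := (lt_div_iff₀ (by positivity)).1 hz.2
    linarith
  obtain ⟨x1, x2⟩ := key x hx
  obtain ⟨y1, y2⟩ := key y hy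
  have c1 : 0 < Real.cos (x * a) := Real.cos_pos_of_mem_Ioo ⟨by linarith, x2⟩
  have c2 : 0 < Real.cos (y * a) := Real.cos_pos_of_mem_Ioo ⟨by linarith, y2⟩
  have h1 : 0 < Real.sinh x := Real.sinh_pos_iff.2 hx.1
  have h2 : 0 < Real.sinh y := Real.sinh_pos_iff.2 hy.1
  have hd : 0 < Real.sinh (y - x) := Real.sinh_pos_iff.2 (by linarith)
  have hs : 0 < Real.sin (y * a - x * a) :=
    Real.sin_pos_of_pos_of_lt_pi (by nlinarith) (by linarith)
  rw [Real.sinh_sub] at hd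
  rw [Real.sin_sub] at hs
  have p := mul_pos hs (mul_pos h1 h2)
  have q := mul_pos hd (mul_pos c1 c2)
  have e : (Real.sin (y * a) * Real.cos (x * a) - Real.cos (y * a) * Real.sin (x * a)) *
      (Real.sinh x * Real.sinh y) = -((Real.sinh y * Real.cosh x - Real.cosh y * Real.sinh x) *
      (Real.cos (x * a) * Real.cos (y * a))) := by
    linear_combination (Real.cos (x * a) * Real.sinh x) * ey -
      (Real.cos (y * a) * Real.sinh y) * ex
  linarith

theorem stmt_4 (a : ℝ) (ha : 0 < a) (ha' : a ≤ 1) :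
    ∃! ν : ℝ, ν ∈ Set.Ioo 0 (Real.pi / (2 * a)) ∧
      Real.sin (ν * a) * Real.sinh ν = Real.cos (ν * a) * Real.cosh ν := by
  have hp : 0 < Real.pi / (2 * a) := by positivity
  have hI := intermediate_value_Ioo (f := fun ν : ℝ => Real.sin (ν * a) * Real.sinh ν -
    Real.cos (ν * a) * Real.cosh ν) hp.le (Continuous.continuousOn (by fun_prop))
  have he : Real.pi / (2 * a) * a = Real.pi / 2 := by field_simp
  have h0 : (0 : ℝ) ∈ Set.Ioo ((fun ν : ℝ => Real.sin (ν * a) * Real.sinh ν -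
    Real.cos (ν * a) * Real.cosh ν) 0) ((fun ν : ℝ => Real.sin (ν * a) * Real.sinh ν -
    Real.cos (ν * a) * Real.cosh ν) (Real.pi / (2 * a))) := by
    constructor
    · simp
    · simp only [he, Real.sin_pi_div_two, Real.cos_pi_div_two]
      have := Real.sinh_pos_iff.2 hp
      linarith
  obtain ⟨x, hx, ex⟩ := hI h0
  have ex' := sub_eq_zero.1 ex
  refine ⟨x, ⟨hx, ex'⟩, ?_⟩
  rintro y ⟨hy, ey⟩
  rcases lt_trichotomy y x with h | h | h
  · exact (stmt_4_aux a ha y x hy hx ey ex' h).elim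
  · exact h
  · exact (stmt_4_aux a ha x y hx hy ex' ey h).elim
end

section
/- Fix a with 0 < a ≤ 1, and let ν be the unique solution in (0, π/(2a)) of the class III(i) equation tan(ν·a) = coth ν. Then for every μ > 0 satisfying the class II(i) equation tan(μ·a) = tanh μ (i.e. sin(μ·a)·cosh μ = cos(μ·a)·sinh μ), one has ν·tanh ν < μ·coth μ. -/
theorem aux_sin (d s : ℝ) (hd : 0 < d) (hds : d < s) (hs : s < Real.pi) :
    d * Real.sin s < s * Real.sin d := by
  have hs0 : 0 < s := hd.trans hds
  have w1 : 0 < 1 - d / s := by rw [sub_pos, div_lt_one hs0]; exact hds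
  have w2 : 0 < d / s := by positivity
  have m1 : (0:ℝ) ∈ Set.Icc 0 Real.pi := ⟨le_refl _, Real.pi_pos.le⟩
  have m2 : s ∈ Set.Icc 0 Real.pi := ⟨hs0.le, hs.le⟩
  have h := strictConcaveOn_sin_Icc.2 m1 m2 hs0.ne w1 w2 (by ring)
  simp only [smul_eq_mul, Real.sin_zero, mul_zero, zero_add] at h
  rw [div_mul_cancel₀ _ hs0.ne', div_mul_eq_mul_div, div_lt_iff₀ hs0] at h
  linarith

theorem aux_cot (x y : ℝ) (hx : 0 < x) (hxy : x < y) (hy : y < Real.pi / 2) :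
    y * Real.cos y * Real.sin x < x * Real.cos x * Real.sin y := by
  have h := aux_sin (y - x) (y + x) (by linarith) (by linarith) (by linarith)
  rw [Real.sin_add, Real.sin_sub] at h
  nlinarith

theorem stmt_5 (a : ℝ) (ha : 0 < a) (ha' : a ≤ 1)
    (ν : ℝ) (hν : ν ∈ Set.Ioo 0 (Real.pi / (2 * a)))
    (hνeq : Real.sin (ν * a) * Real.sinh ν = Real.cos (ν * a) * Real.cosh ν) :
    ∀ μ : ℝ, 0 < μ →
      Real.sin (μ * a) * Real.cosh μ = Real.cos (μ * a) * Real.sinh μ →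
      ν * Real.tanh ν < μ * (Real.cosh μ / Real.sinh μ) := by
  intro μ hμ hμeq
  obtain ⟨hν0, hν1⟩ := hν
  have hνa : ν * a < Real.pi / 2 := by
    rw [lt_div_iff₀ (by positivity)] at hν1
    linarith
  have hsμ : 0 < Real.sinh μ := Real.sinh_pos_iff.2 hμ
  have hcμ := Real.cosh_pos μ
  have hcν := Real.cosh_pos ν
  rw [Real.tanh_eq_sinh_div_cosh]
  rcases lt_or_ge μ ν with h | h
  · have hlt : μ * a < ν * a := by gcongr
    have hm : 0 < μ * a := by positivity
    have hs1 : 0 < Real.sin (μ * a) := Real.sin_pos_of_pos_of_lt_pi hm (by linarith [Real.pi_pos])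
    have hs2 : 0 < Real.sin (ν * a) := Real.sin_pos_of_pos_of_lt_pi (by linarith) (by linarith [Real.pi_pos])
    have key := aux_cot _ _ hm hlt hνa
    have e1 : Real.sinh ν / Real.cosh ν = Real.cos (ν * a) / Real.sin (ν * a) := by
      rw [div_eq_div_iff hcν.ne' hs2.ne']; linarith
    have e2 : Real.cosh μ / Real.sinh μ = Real.cos (μ * a) / Real.sin (μ * a) := by
      rw [div_eq_div_iff hsμ.ne' hs1.ne']; linarith
    rw [e1, e2, ← mul_div_assoc, ← mul_div_assoc, div_lt_div_iff₀ hs2 hs1]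
    refine lt_of_mul_lt_mul_left ?_ ha.le
    linarith
  · have h1 : Real.sinh ν / Real.cosh ν < 1 := by
      rw [div_lt_one hcν]; exact Real.sinh_lt_cosh ν
    have h2 : 1 < Real.cosh μ / Real.sinh μ := by
      rw [one_lt_div hsμ]; exact Real.sinh_lt_cosh μ
    nlinarith
end

section
/- Fix a with 0 < a < 1. Let ν be the unique solution in (0, π/2) of the class IV(ii) equation tan ν = coth(ν·a), and let μ be the unique solution in (0, π/(2a)) of the class III(i) equation tan(μ·a) = coth μ. Then ν·tanh(ν·a) < μ·tanh μ. Moreover, when a = 1 the two equations coincide, the two roots are equal, and ν·tanh(ν·a) = μ·tanh μ. -/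
theorem sinh_aux (a x : ℝ) (ha : 0 < a) (ha' : a ≤ 1) (hx : 0 < x) :
    a * (Real.sinh x * Real.cosh (x * a)) ≤ Real.sinh (x * a) * Real.cosh x := by
  let f : ℝ → ℝ := fun x => Real.sinh (x * a) * Real.cosh x - a * (Real.sinh x * Real.cosh (x * a))
  have hd : ∀ y, HasDerivAt f ((1 - a ^ 2) * (Real.sinh y * Real.sinh (y * a))) y := by
    intro y
    have h1 : HasDerivAt (fun y : ℝ => y * a) a y := by simpa using (hasDerivAt_id y).mul_const a
    have h := (h1.sinh.mul (Real.hasDerivAt_cosh y)).sub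
      (((Real.hasDerivAt_sinh y).mul h1.cosh).const_mul a)
    refine h.congr_deriv ?_
    ring
  have hm : MonotoneOn f (Set.Ici 0) := by
    apply monotoneOn_of_deriv_nonneg (convex_Ici 0)
    · exact fun y _ => (hd y).continuousAt.continuousWithinAt
    · exact fun y _ => (hd y).differentiableAt.differentiableWithinAt
    · intro y hy
      rw [interior_Ici] at hy
      have hy : 0 < y := hy
      rw [(hd y).deriv]
      have := Real.sinh_pos_iff.2 hy
      have := Real.sinh_pos_iff.2 (mul_pos hy ha)
      have : 0 ≤ 1 - a ^ 2 := by nlinarith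
      positivity
  have := hm (Set.mem_Ici.2 le_rfl) (Set.mem_Ici.2 hx.le) hx.le
  simp only [f, zero_mul, Real.sinh_zero, mul_zero, sub_zero] at this
  linarith

theorem sin_aux (a x : ℝ) (ha : 0 < a) (ha' : a ≤ 1) (hx : 0 < x) (hx2 : x < Real.pi / 2) :
    Real.sin (x * a) * Real.cos x ≤ a * (Real.sin x * Real.cos (x * a)) := by
  let f : ℝ → ℝ := fun x => a * (Real.sin x * Real.cos (x * a)) - Real.sin (x * a) * Real.cos x
  have hd : ∀ y, HasDerivAt f ((1 - a ^ 2) * (Real.sin y * Real.sin (y * a))) y := by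
    intro y
    have h1 : HasDerivAt (fun y : ℝ => y * a) a y := by simpa using (hasDerivAt_id y).mul_const a
    have h := (((Real.hasDerivAt_sin y).mul h1.cos).const_mul a).sub
      (h1.sin.mul (Real.hasDerivAt_cos y))
    refine h.congr_deriv ?_
    ring
  have hm : MonotoneOn f (Set.Icc 0 (Real.pi / 2)) := by
    apply monotoneOn_of_deriv_nonneg (convex_Icc _ _)
    · exact fun y _ => (hd y).continuousAt.continuousWithinAt
    · exact fun y _ => (hd y).differentiableAt.differentiableWithinAt
    · intro y hy
      rw [interior_Icc] at hy
      obtain ⟨hy, hy2⟩ := hy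
      rw [(hd y).deriv]
      have := Real.sin_pos_of_pos_of_lt_pi hy (by linarith)
      have := Real.sin_pos_of_pos_of_lt_pi (mul_pos hy ha) (by nlinarith)
      have : 0 ≤ 1 - a ^ 2 := by nlinarith
      positivity
  have := hm (⟨le_rfl, by linarith⟩) (⟨hx.le, hx2.le⟩) hx.le
  simp only [f, zero_mul, Real.sin_zero, mul_zero, sub_zero] at this
  linarith

theorem root_le (a : ℝ) (ha : 0 < a) (ha' : a ≤ 1)
    (ν : ℝ) (hν : ν ∈ Set.Ioo 0 (Real.pi / 2))
    (hνeq : Real.sin ν * Real.sinh (ν * a) = Real.cos ν * Real.cosh (ν * a))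
    (μ : ℝ) (hμ : 0 < μ)
    (hμeq : Real.sin (μ * a) * Real.sinh μ = Real.cos (μ * a) * Real.cosh μ) : ν ≤ μ := by
  by_contra! hlt
  obtain ⟨h0, h1⟩ := hν
  have hμ2 : μ < Real.pi / 2 := by linarith
  have A := sinh_aux a μ ha ha' hμ
  have B := sin_aux a μ ha ha' hμ hμ2
  have hμa : μ * a < Real.pi / 2 := by nlinarith
  have p1 := Real.sinh_pos_iff.2 hμ
  have p2 := Real.sinh_pos_iff.2 (mul_pos hμ ha)
  have p3 := Real.sinh_pos_iff.2 (mul_pos h0 ha)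
  have q1 := Real.cosh_pos μ
  have q2 := Real.cosh_pos (μ * a)
  have q3 := Real.cosh_pos (ν * a)
  have r1 := Real.cos_pos_of_mem_Ioo (x := μ) ⟨by linarith, hμ2⟩
  have r2 := Real.cos_pos_of_mem_Ioo (x := μ * a) ⟨by nlinarith, hμa⟩
  have r3 := Real.cos_pos_of_mem_Ioo (x := ν) ⟨by linarith, h1⟩
  have s1 := Real.sin_pos_of_pos_of_lt_pi hμ (by linarith)
  have s2 := Real.sin_pos_of_pos_of_lt_pi (mul_pos hμ ha) (by linarith)
  have s3 := Real.sin_pos_of_pos_of_lt_pi h0 (by linarith)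
  have C := Real.sin_pos_of_pos_of_lt_pi (x := ν - μ) (by linarith) (by linarith)
  have D := Real.sinh_pos_iff.2 (show 0 < ν * a - μ * a by nlinarith)
  rw [Real.sin_sub] at C
  rw [Real.sinh_sub] at D
  have E1 : Real.cos μ * Real.cosh (μ * a) ≤ Real.sin μ * Real.sinh (μ * a) := by
    have e1 := mul_le_mul_of_nonneg_right B (mul_pos p1 q2).le
    have e2 := mul_le_mul_of_nonneg_left A (mul_pos s1 r2).le
    refine le_of_mul_le_mul_left ?_ (mul_pos r2 q1)
    have e3 := congrArg (· * (Real.cos μ * Real.cosh (μ * a))) hμeq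
    linarith
  have E2 : Real.sin μ * Real.sinh (μ * a) < Real.cos μ * Real.cosh (μ * a) := by
    have e1 := mul_lt_mul_of_pos_right C (mul_pos q2 p3)
    have e2 := mul_lt_mul_of_pos_left D (mul_pos r3 s1)
    refine lt_of_mul_lt_mul_left ?_ (mul_pos s3 p3).le
    have e3 := congrArg (· * (Real.sin μ * Real.sinh (μ * a))) hνeq
    linarith
  linarith

theorem tanh_lt_aux {x y : ℝ} (h : x < y) : Real.tanh x < Real.tanh y := by
  rw [Real.tanh_eq_sinh_div_cosh, Real.tanh_eq_sinh_div_cosh,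
    div_lt_div_iff₀ (Real.cosh_pos _) (Real.cosh_pos _)]
  have := Real.sinh_pos_iff.2 (sub_pos.2 h)
  rw [Real.sinh_sub] at this
  linarith

theorem stmt_6 (a : ℝ) (ha : 0 < a) (ha' : a ≤ 1)
    (ν : ℝ) (hν : ν ∈ Set.Ioo 0 (Real.pi / 2))
    (hνeq : Real.sin ν * Real.sinh (ν * a) = Real.cos ν * Real.cosh (ν * a))
    (μ : ℝ) (hμ : μ ∈ Set.Ioo 0 (Real.pi / (2 * a)))
    (hμeq : Real.sin (μ * a) * Real.sinh μ = Real.cos (μ * a) * Real.cosh μ) :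
    (a < 1 → ν * Real.tanh (ν * a) < μ * Real.tanh μ) ∧
    (a = 1 → ν = μ ∧ ν * Real.tanh (ν * a) = μ * Real.tanh μ) := by
  have hle := root_le a ha ha' ν hν hνeq μ hμ.1 hμeq
  refine ⟨fun h => ?_, fun h => ?_⟩
  · have h0 := hν.1
    have h1 : Real.tanh (ν * a) < Real.tanh μ := tanh_lt_aux (by nlinarith)
    have h2 : 0 < Real.tanh μ := by
      have := tanh_lt_aux hμ.1
      rwa [Real.tanh_zero] at this
    nlinarith
  · subst h
    have hge := root_le 1 ha ha' μ (by simpa using hμ) (by simpa using hμeq) ν hν.1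
      (by simpa using hνeq)
    have e := le_antisymm hle hge
    subst e
    simp
end

section
/- Fix a with 0 < a ≤ 1, and let ν be the unique solution in (0, π/(2a)) of the class III(i) equation tan(ν·a) = coth ν. Then for every μ > 0 satisfying the class I(i) equation tan(μ·a) + tanh μ = 0, one has ν·tanh ν < μ·tanh μ. -/
theorem stmt_7 (a : ℝ) (ha : 0 < a) (ha' : a ≤ 1)
    (ν : ℝ) (hν : ν ∈ Set.Ioo 0 (Real.pi / (2 * a)))
    (hνeq : Real.sin (ν * a) * Real.sinh ν = Real.cos (ν * a) * Real.cosh ν) :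
    ∀ μ : ℝ, 0 < μ → Real.tan (μ * a) + Real.tanh μ = 0 →
      ν * Real.tanh ν < μ * Real.tanh μ := by
  intro μ hμ h
  obtain ⟨h0, h1⟩ := hν
  have htanh : ∀ x : ℝ, 0 < x → 0 < Real.tanh x := fun x hx => by
    rw [Real.tanh_eq_sinh_div_cosh]
    exact div_pos (Real.sinh_pos_iff.mpr hx) (Real.cosh_pos x)
  have h2 : ν * a < Real.pi / 2 := by
    rw [lt_div_iff₀ (by positivity)] at h1
    linarith
  have hlt : ν < μ := by
    by_contra hc
    push Not at hc
    have h3 : μ * a ≤ ν * a := mul_le_mul_of_nonneg_right hc ha.le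
    have h4 := Real.tan_pos_of_pos_of_lt_pi_div_two (mul_pos hμ ha) (lt_of_le_of_lt h3 h2)
    linarith [htanh μ hμ]
  have hm : Real.tanh ν < Real.tanh μ := by
    rw [Real.tanh_eq_sinh_div_cosh, Real.tanh_eq_sinh_div_cosh,
      div_lt_div_iff₀ (Real.cosh_pos _) (Real.cosh_pos _)]
    have := Real.sinh_pos_iff.mpr (sub_pos.mpr hlt)
    rw [Real.sinh_sub] at this
    linarith
  exact mul_lt_mul'' hlt hm h0.le (htanh ν h0).le
end

section
/- Fix a with 0 < a ≤ 1, and let ν be the unique solution in (0, π/2) of the class IV(ii) equation tan ν = coth(ν·a). Then for every μ > 0 satisfying the class I(ii) equation tan μ + tanh(μ·a) = 0, one has ν·tanh(ν·a) < μ·tanh(μ·a). -/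
theorem stmt_8 (a : ℝ) (ha : 0 < a) (ha' : a ≤ 1)
    (ν : ℝ) (hν : ν ∈ Set.Ioo 0 (Real.pi / 2))
    (hνeq : Real.sin ν * Real.sinh (ν * a) = Real.cos ν * Real.cosh (ν * a)) :
    ∀ μ : ℝ, 0 < μ → Real.tan μ + Real.tanh (μ * a) = 0 →
      ν * Real.tanh (ν * a) < μ * Real.tanh (μ * a) := by
  intro μ hμ h
  have hpos : ∀ x : ℝ, 0 < x → 0 < Real.tanh x := by
    intro x hx
    rw [Real.tanh_eq_sinh_div_cosh]
    exact div_pos (Real.sinh_pos_iff.2 hx) (Real.cosh_pos x)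
  have hmono : ∀ x y : ℝ, x < y → Real.tanh x < Real.tanh y := by
    intro x y hxy
    rw [Real.tanh_eq_sinh_div_cosh, Real.tanh_eq_sinh_div_cosh,
      div_lt_div_iff₀ (Real.cosh_pos x) (Real.cosh_pos y)]
    have h1 := Real.sinh_sub y x
    have h2 := Real.sinh_pos_iff.2 (sub_pos.2 hxy)
    linarith
  have hμ2 : Real.pi / 2 < μ := by
    by_contra hc
    have h1 := Real.tan_nonneg_of_nonneg_of_le_pi_div_two hμ.le (not_lt.1 hc)
    have h2 := hpos _ (mul_pos hμ ha)
    linarith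
  have hlt : ν < μ := hν.2.trans hμ2
  exact mul_lt_mul hlt (hmono _ _ (mul_lt_mul_of_pos_right hlt ha)).le
    (hpos _ (mul_pos hν.1 ha)) hμ.le
end

section
/- Fix a with 0 < a ≤ 1, and let ν be the unique solution in (0, π/2) of the class IV(ii) equation tan ν = coth(ν·a). Then for every μ > 0 satisfying the class II(ii) equation tan μ = tanh(μ·a), one has ν·tanh(ν·a) < μ·coth(μ·a). -/
theorem aux_sinh_le (t : ℝ) (ht : 0 ≤ t) : Real.sinh t ≤ t * Real.cosh t := by
  have hd : ∀ x : ℝ, HasDerivAt (fun x => x * Real.cosh x - Real.sinh x)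
      (x * Real.sinh x) x := by
    intro x
    have := ((hasDerivAt_id x).mul (Real.hasDerivAt_cosh x)).sub (Real.hasDerivAt_sinh x)
    exact this.congr_deriv (by simp)
  have hm : MonotoneOn (fun x => x * Real.cosh x - Real.sinh x) (Set.Ici 0) := by
    apply monotoneOn_of_deriv_nonneg (convex_Ici 0)
    · exact fun x _ => (hd x).continuousAt.continuousWithinAt
    · exact fun x _ => (hd x).differentiableAt.differentiableWithinAt
    · intro x hx
      rw [interior_Ici] at hx
      rw [(hd x).deriv]
      exact mul_nonneg (le_of_lt hx) (Real.sinh_nonneg_iff.2 (le_of_lt hx))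
  have := hm (Set.mem_Ici.2 le_rfl) (Set.mem_Ici.2 ht) ht
  simp at this
  linarith

theorem stmt_9 (a : ℝ) (ha : 0 < a) (ha' : a ≤ 1)
    (ν : ℝ) (hν : ν ∈ Set.Ioo 0 (Real.pi / 2))
    (hνeq : Real.sin ν * Real.sinh (ν * a) = Real.cos ν * Real.cosh (ν * a)) :
    ∀ μ : ℝ, 0 < μ → Real.tan μ = Real.tanh (μ * a) →
      ν * Real.tanh (ν * a) < μ * (Real.cosh (μ * a) / Real.sinh (μ * a)) := by
  intro μ hμ h
  obtain ⟨h0, h1⟩ := hν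
  have hμa : 0 < μ * a := mul_pos hμ ha
  have h2 : Real.pi / 2 ≤ μ := by
    by_contra hc
    have h3 := Real.lt_tan hμ (not_le.1 hc)
    have h4 : Real.tanh (μ * a) ≤ μ * a := by
      rw [Real.tanh_eq_sinh_div_cosh, div_le_iff₀ (Real.cosh_pos _)]
      exact aux_sinh_le _ hμa.le
    nlinarith
  have h5 : Real.tanh (ν * a) < 1 := by
    rw [Real.tanh_eq_sinh_div_cosh, div_lt_one (Real.cosh_pos _)]
    exact Real.sinh_lt_cosh _
  have h6 : 1 < Real.cosh (μ * a) / Real.sinh (μ * a) := by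
    rw [one_lt_div (Real.sinh_pos_iff.2 hμa)]
    exact Real.sinh_lt_cosh _
  have h7 := mul_lt_mul_of_pos_left h5 h0
  have h8 := mul_lt_mul_of_pos_left h6 hμ
  linarith
end

section
/- Fix a with 0 < a ≤ 1, and let ν be the unique solution in (0, π/2) of the class IV(ii) equation tan ν = coth(ν·a). Then for every μ > 0 satisfying the class III(ii) equation tan μ + coth(μ·a) = 0, one has ν·tanh(ν·a) < μ·coth(μ·a). -/
theorem stmt_10 (a : ℝ) (ha : 0 < a) (ha' : a ≤ 1)
    (ν : ℝ) (hν : ν ∈ Set.Ioo 0 (Real.pi / 2))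
    (hνeq : Real.sin ν * Real.sinh (ν * a) = Real.cos ν * Real.cosh (ν * a)) :
    ∀ μ : ℝ, 0 < μ → Real.tan μ + Real.cosh (μ * a) / Real.sinh (μ * a) = 0 →
      ν * Real.tanh (ν * a) < μ * (Real.cosh (μ * a) / Real.sinh (μ * a)) := by
  intro μ hμ h
  obtain ⟨h0, h1⟩ := hν
  have hs : 0 < Real.sinh (μ * a) := Real.sinh_pos_iff.mpr (by positivity)
  have hc : 1 < Real.cosh (μ * a) / Real.sinh (μ * a) := by
    rw [one_lt_div hs]; exact Real.sinh_lt_cosh _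
  have hμ2 : Real.pi / 2 < μ := by
    by_contra hcon
    have := Real.tan_nonneg_of_nonneg_of_le_pi_div_two hμ.le (not_lt.mp hcon)
    linarith
  have ht : Real.tanh (ν * a) < 1 := by
    rw [Real.tanh_eq_sinh_div_cosh, div_lt_one (Real.cosh_pos _)]
    exact Real.sinh_lt_cosh _
  nlinarith [mul_lt_mul_of_pos_left ht h0, mul_lt_mul_of_pos_left hc hμ]
end

section
/- Fix a with 0 < a ≤ 1, and let ν be the unique solution in (0, π/2) of the class IV(ii) equation tan ν = coth(ν·a). Then for every μ > 0 satisfying the class IV(i) equation tan(μ·a) + coth μ = 0, one has ν·tanh(ν·a) < μ·coth μ. -/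
theorem stmt_11 (a : ℝ) (ha : 0 < a) (ha' : a ≤ 1)
    (ν : ℝ) (hν : ν ∈ Set.Ioo 0 (Real.pi / 2))
    (hνeq : Real.sin ν * Real.sinh (ν * a) = Real.cos ν * Real.cosh (ν * a)) :
    ∀ μ : ℝ, 0 < μ → Real.tan (μ * a) + Real.cosh μ / Real.sinh μ = 0 →
      ν * Real.tanh (ν * a) < μ * (Real.cosh μ / Real.sinh μ) := by
  intro μ hμ h
  obtain ⟨h0, h1⟩ := hν
  have hs : 0 < Real.sinh μ := Real.sinh_pos_iff.mpr hμ
  have hc : 1 < Real.cosh μ / Real.sinh μ := by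
    rw [one_lt_div hs]
    exact Real.sinh_lt_cosh μ
  have hbig : Real.pi / 2 < μ := by
    by_contra hcon
    push Not at hcon
    have h2 : μ * a ≤ Real.pi / 2 := by nlinarith
    have := Real.tan_nonneg_of_nonneg_of_le_pi_div_two (by positivity) h2
    linarith
  have ht : Real.tanh (ν * a) < 1 := by
    rw [Real.tanh_eq_sinh_div_cosh, div_lt_one (Real.cosh_pos _)]
    exact Real.sinh_lt_cosh _
  have e1 : ν * Real.tanh (ν * a) < ν * 1 := mul_lt_mul_of_pos_left ht h0
  have e2 : μ * 1 < μ * (Real.cosh μ / Real.sinh μ) := mul_lt_mul_of_pos_left hc hμ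
  linarith
end

section
/- There exists a differentiable function N : (0,1) → ℝ such that for every a ∈ (0,1), N(a) lies in (0, π/2) and is the unique solution in (0, π/2) of cot(N(a)) = tanh(N(a)·a); consequently the function a ↦ N(a)·tanh(N(a)·a) is differentiable on (0,1). -/
namespace Stek

noncomputable def F (p : ℝ × ℝ) : ℝ :=
  Real.cos p.2 * Real.cosh (p.2 * p.1) - Real.sin p.2 * Real.sinh (p.2 * p.1)

lemma F_deriv (a x : ℝ) : HasDerivAt (fun v => F (a, v))
    (-((1 + a) * (Real.sin x * Real.cosh (x * a)) + (1 - a) * (Real.cos x * Real.sinh (x * a)))) x := by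
  have h1 : HasDerivAt (fun v : ℝ => v * a) a x := by simpa using (hasDerivAt_id x).mul_const a
  have h := ((Real.hasDerivAt_cos x).mul h1.cosh).sub ((Real.hasDerivAt_sin x).mul h1.sinh)
  have e : (fun v => F (a, v)) =
    (Real.cos * fun v => Real.cosh (v * a)) - (Real.sin * fun v => Real.sinh (v * a)) := by
      funext v; simp [F]
  rw [e]
  refine h.congr_deriv ?_
  ring

lemma F_deriv_neg {a x : ℝ} (ha : a ∈ Set.Ioo (0:ℝ) 1) (hx : x ∈ Set.Ioo 0 (Real.pi / 2)) :
    (-((1 + a) * (Real.sin x * Real.cosh (x * a)) + (1 - a) * (Real.cos x * Real.sinh (x * a)))) < 0 := by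
  have h1 : 0 < Real.sin x := Real.sin_pos_of_pos_of_lt_pi hx.1 (by linarith [hx.2, Real.pi_pos])
  have h2 : 0 < Real.cos x := Real.cos_pos_of_mem_Ioo ⟨by linarith [hx.1, Real.pi_pos], hx.2⟩
  have h3 := Real.cosh_pos (x * a)
  have h4 : 0 < Real.sinh (x * a) := Real.sinh_pos_iff.2 (mul_pos hx.1 ha.1)
  have h5 : 0 < 1 - a := by linarith [ha.2]
  have h6 : 0 < 1 + a := by linarith [ha.1]
  rw [neg_lt_zero]
  positivity

lemma F_contDiff : ContDiff ℝ 1 F := by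
  unfold F
  fun_prop

lemma F_cont (a : ℝ) : Continuous (fun v => F (a, v)) :=
  F_contDiff.continuous.comp (by fun_prop)

lemma F_anti {a : ℝ} (ha : a ∈ Set.Ioo (0:ℝ) 1) :
    StrictAntiOn (fun v => F (a, v)) (Set.Icc 0 (Real.pi / 2)) := by
  apply strictAntiOn_of_deriv_neg (convex_Icc _ _) (F_cont a).continuousOn
  intro x hx
  rw [interior_Icc] at hx
  rw [(F_deriv a x).deriv]
  exact F_deriv_neg ha hx

lemma F_exists {a : ℝ} (ha : a ∈ Set.Ioo (0:ℝ) 1) :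
    ∃ v ∈ Set.Ioo 0 (Real.pi / 2), F (a, v) = 0 := by
  have hp : 0 ≤ Real.pi / 2 := by positivity
  apply intermediate_value_Ioo' hp (F_cont a).continuousOn
  have : 0 < Real.sinh (Real.pi / 2 * a) := Real.sinh_pos_iff.2 (mul_pos (by positivity) ha.1)
  simp [F, this]

lemma F_iff {a v : ℝ} (hv : v ∈ Set.Ioo 0 (Real.pi / 2)) :
    Real.cot v = Real.tanh (v * a) ↔ F (a, v) = 0 := by
  have h1 : 0 < Real.sin v := Real.sin_pos_of_pos_of_lt_pi hv.1 (by linarith [hv.2, Real.pi_pos])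
  rw [Real.cot_eq_cos_div_sin, Real.tanh_eq_sinh_div_cosh,
    div_eq_div_iff h1.ne' (Real.cosh_pos _).ne', F, sub_eq_zero, mul_comm (Real.sinh _)]

end Stek

open Stek in
theorem stmt_13 :
    ∃ N : ℝ → ℝ, DifferentiableOn ℝ N (Set.Ioo 0 1) ∧
      (∀ a ∈ Set.Ioo (0 : ℝ) 1,
        N a ∈ Set.Ioo 0 (Real.pi / 2) ∧
        Real.cot (N a) = Real.tanh (N a * a) ∧
        (∀ ν ∈ Set.Ioo 0 (Real.pi / 2), Real.cot ν = Real.tanh (ν * a) → ν = N a)) ∧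
      DifferentiableOn ℝ (fun a => N a * Real.tanh (N a * a)) (Set.Ioo 0 1) := by
  have hex : ∀ a : ℝ, ∃ v, a ∈ Set.Ioo (0:ℝ) 1 → v ∈ Set.Ioo 0 (Real.pi / 2) ∧ F (a, v) = 0 := by
    intro a
    by_cases ha : a ∈ Set.Ioo (0:ℝ) 1
    · obtain ⟨v, hv⟩ := F_exists ha
      exact ⟨v, fun _ => hv⟩
    · exact ⟨0, fun h => absurd h ha⟩
  choose N hN using hex
  have huniq : ∀ a ∈ Set.Ioo (0:ℝ) 1, ∀ v ∈ Set.Ioo 0 (Real.pi / 2), F (a, v) = 0 → v = N a := by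
    intro a ha v hv h
    exact (F_anti ha).injOn (Set.Ioo_subset_Icc_self hv) (Set.Ioo_subset_Icc_self (hN a ha).1)
      (h.trans (hN a ha).2.symm)
  have hd : DifferentiableOn ℝ N (Set.Ioo 0 1) := by
    intro a ha
    apply DifferentiableAt.differentiableWithinAt
    obtain ⟨hm, h0⟩ := hN a ha
    have dfu : HasStrictFDerivAt F (fderiv ℝ F (a, N a)) (a, N a) :=
      F_contDiff.contDiffAt.hasStrictFDerivAt (by simp)
    have hval : (fderiv ℝ F (a, N a)) (0, 1) ≠ 0 := by
      have h1 : HasDerivAt (fun v : ℝ => (a, v)) ((0:ℝ), (1:ℝ)) (N a) :=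
        (hasDerivAt_const _ _).prodMk (hasDerivAt_id _)
      have h2 := dfu.hasFDerivAt.comp_hasDerivAt (N a) h1
      have h3 := h2.unique (F_deriv a (N a))
      rw [h3]
      exact (F_deriv_neg ha hm).ne
    have hinv : ((fderiv ℝ F (a, N a)) ∘L .inr ℝ ℝ ℝ).IsInvertible := by
      refine ⟨ContinuousLinearEquiv.unitsEquivAut ℝ (Units.mk0 _ hval), ?_⟩
      ext
      simp
    have hs := dfu.hasStrictFDerivAt_implicitFunctionOfProdDomain hinv
    have ht := dfu.tendsto_implicitFunctionOfProdDomain hinv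
    have he := dfu.eventually_apply_implicitFunctionOfProdDomain hinv
    refine hs.hasFDerivAt.differentiableAt.congr_of_eventuallyEq ?_
    filter_upwards [he, ht.eventually (isOpen_Ioo.mem_nhds hm), isOpen_Ioo.mem_nhds ha]
      with x h1 h2 h3
    exact (huniq x h3 _ h2 (h1.trans h0)).symm
  refine ⟨N, hd, fun a ha => ⟨(hN a ha).1, (F_iff (hN a ha).1).2 (hN a ha).2,
    fun v hv h => huniq a ha v hv ((F_iff hv).1 h)⟩, ?_⟩
  have hm : DifferentiableOn ℝ (fun a => N a * a) (Set.Ioo 0 1) := hd.mul differentiableOn_id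
  simp only [Real.tanh_eq_sinh_div_cosh]
  exact hd.mul (hm.sinh.div hm.cosh fun x _ => (Real.cosh_pos _).ne')
end

section
/- For 0 < a₁ < a₂ ≤ 1, let ν₁ and ν₂ be the unique solutions in (0, π/2) of tan ν = coth(ν·a₁) and tan ν = coth(ν·a₂) respectively. Then ν₁·tanh(ν₁·a₁) < ν₂·tanh(ν₂·a₂). -/
theorem stmt_14 (a₁ a₂ : ℝ) (ha₁ : 0 < a₁) (h12 : a₁ < a₂) (ha₂ : a₂ ≤ 1)
    (ν₁ : ℝ) (hν₁ : ν₁ ∈ Set.Ioo 0 (Real.pi / 2))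
    (hν₁eq : Real.tan ν₁ = Real.cosh (ν₁ * a₁) / Real.sinh (ν₁ * a₁))
    (ν₂ : ℝ) (hν₂ : ν₂ ∈ Set.Ioo 0 (Real.pi / 2))
    (hν₂eq : Real.tan ν₂ = Real.cosh (ν₂ * a₂) / Real.sinh (ν₂ * a₂)) :
    ν₁ * Real.tanh (ν₁ * a₁) < ν₂ * Real.tanh (ν₂ * a₂) := by
  obtain ⟨h1, h1'⟩ := hν₁
  obtain ⟨h2, h2'⟩ := hν₂
  have s1 : 0 < Real.sinh (ν₁ * a₁) := Real.sinh_pos_iff.2 (by positivity)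
  have s2 : 0 < Real.sinh (ν₂ * a₂) := Real.sinh_pos_iff.2 (mul_pos h2 (by linarith))
  have hlt : ν₂ < ν₁ := by
    by_contra! hle
    have ht : Real.tan ν₁ ≤ Real.tan ν₂ := by
      rcases hle.eq_or_lt with h | h
      · rw [h]
      · exact (Real.tan_lt_tan_of_nonneg_of_lt_pi_div_two h1.le h2' h).le
    have hd : 0 < Real.sinh (ν₂ * a₂ - ν₁ * a₁) := Real.sinh_pos_iff.2 (by nlinarith)
    rw [Real.sinh_sub] at hd
    rw [hν₁eq, hν₂eq, div_le_div_iff₀ s1 s2] at ht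
    linarith
  have e1 : Real.tanh (ν₁ * a₁) = Real.cos ν₁ / Real.sin ν₁ := by
    rw [Real.tanh_eq_sinh_div_cosh, ← inv_div, ← hν₁eq, Real.tan_eq_sin_div_cos, inv_div]
  have e2 : Real.tanh (ν₂ * a₂) = Real.cos ν₂ / Real.sin ν₂ := by
    rw [Real.tanh_eq_sinh_div_cosh, ← inv_div, ← hν₂eq, Real.tan_eq_sin_div_cos, inv_div]
  have p1 := Real.sin_pos_of_pos_of_lt_pi h1 (by linarith)
  have p2 := Real.sin_pos_of_pos_of_lt_pi h2 (by linarith)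
  rw [e1, e2, ← mul_div_assoc, ← mul_div_assoc, div_lt_div_iff₀ p1 p2]
  have hs : 0 < ν₁ + ν₂ := by linarith
  have w1 : 0 < 2 * ν₂ / (ν₁ + ν₂) := by positivity
  have w2 : 0 < (ν₁ - ν₂) / (ν₁ + ν₂) := div_pos (by linarith) hs
  have w : 2 * ν₂ / (ν₁ + ν₂) + (ν₁ - ν₂) / (ν₁ + ν₂) = 1 := by field_simp; ring
  have m0 : (0 : ℝ) ∈ Set.Icc 0 Real.pi := ⟨le_rfl, Real.pi_pos.le⟩
  have m1 : ν₁ + ν₂ ∈ Set.Icc 0 Real.pi := ⟨hs.le, by linarith⟩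
  have hc := strictConcaveOn_sin_Icc.2
  have key := hc m0 m1 hs.ne w1 w2 w
  simp only [smul_eq_mul, mul_zero, Real.sin_zero, zero_add] at key
  rw [div_mul_cancel₀ _ hs.ne', div_mul_eq_mul_div, div_lt_iff₀ hs, Real.sin_add,
    Real.sin_sub] at key
  nlinarith
end

section
/- Let a, b, c > 0 and λ₁, λ₂ > 0, write Λ = √(λ₁² + λ₂²), and suppose σ := λ₁·tanh(λ₁·a) = λ₂·tanh(λ₂·b) and σ·sin(Λ·c) = Λ·cos(Λ·c). Define s : ℝ³ → ℝ by s(x,y,z) = cosh(λ₁·x)·cosh(λ₂·y)·sin(Λ·z). Then s is harmonic (the sum of its three pure second partial derivatives is identically zero), and on the boundary of the box [-a,a]×[-b,b]×[-c,c] the outward normal derivative of s equals σ·s: ∂s/∂x(±a,y,z) = ±σ·s(±a,y,z), ∂s/∂y(x,±b,z) = ±σ·s(x,±b,z), and ∂s/∂z(x,y,±c) = ±σ·s(x,y,±c). -/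
theorem stmt_17 (a b c : ℝ) (ha : 0 < a) (hb : 0 < b) (hc : 0 < c)
    (l₁ l₂ : ℝ) (hl₁ : 0 < l₁) (hl₂ : 0 < l₂)
    (Λ : ℝ) (hΛ : Λ = Real.sqrt (l₁ ^ 2 + l₂ ^ 2))
    (σ : ℝ) (hσ : σ = l₁ * Real.tanh (l₁ * a))
    (hσb : σ = l₂ * Real.tanh (l₂ * b))
    (hσc : σ * Real.sin (Λ * c) = Λ * Real.cos (Λ * c))
    (s : ℝ → ℝ → ℝ → ℝ)
    (hs : ∀ x y z, s x y z = Real.cosh (l₁ * x) * Real.cosh (l₂ * y) * Real.sin (Λ * z)) :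
    (∀ x y z : ℝ,
      deriv (fun x' => deriv (fun x'' => s x'' y z) x') x +
        deriv (fun y' => deriv (fun y'' => s x y'' z) y') y +
        deriv (fun z' => deriv (fun z'' => s x y z'') z') z = 0) ∧
    (∀ y ∈ Set.Icc (-b) b, ∀ z ∈ Set.Icc (-c) c,
      deriv (fun x => s x y z) a = σ * s a y z ∧
      deriv (fun x => s x y z) (-a) = -(σ * s (-a) y z)) ∧
    (∀ x ∈ Set.Icc (-a) a, ∀ z ∈ Set.Icc (-c) c,
      deriv (fun y => s x y z) b = σ * s x b z ∧
      deriv (fun y => s x y z) (-b) = -(σ * s x (-b) z)) ∧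
    (∀ x ∈ Set.Icc (-a) a, ∀ y ∈ Set.Icc (-b) b,
      deriv (fun z => s x y z) c = σ * s x y c ∧
      deriv (fun z => s x y z) (-c) = -(σ * s x y (-c))) := by
  have lin : ∀ k x : ℝ, HasDerivAt (fun x : ℝ => k * x) k x := fun k x => by
    simpa using (hasDerivAt_id x).const_mul k
  have hC : ∀ k x : ℝ, HasDerivAt (fun x : ℝ => Real.cosh (k * x)) (Real.sinh (k * x) * k) x :=
    fun k x => (lin k x).cosh
  have hS : ∀ k x : ℝ, HasDerivAt (fun x : ℝ => Real.sinh (k * x)) (Real.cosh (k * x) * k) x :=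
    fun k x => (lin k x).sinh
  have hsn : ∀ k x : ℝ, HasDerivAt (fun x : ℝ => Real.sin (k * x)) (Real.cos (k * x) * k) x :=
    fun k x => (lin k x).sin
  have hcs : ∀ k x : ℝ, HasDerivAt (fun x : ℝ => Real.cos (k * x)) (-Real.sin (k * x) * k) x :=
    fun k x => (lin k x).cos
  have dx : ∀ x y z, deriv (fun x => s x y z) x
      = Real.sinh (l₁ * x) * l₁ * Real.cosh (l₂ * y) * Real.sin (Λ * z) := fun x y z => by
    simp only [hs]
    exact (((hC l₁ x).mul_const _).mul_const _).deriv
  have dy : ∀ x y z, deriv (fun y => s x y z) y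
      = Real.cosh (l₁ * x) * (Real.sinh (l₂ * y) * l₂) * Real.sin (Λ * z) := fun x y z => by
    simp only [hs]
    exact (((hC l₂ y).const_mul _).mul_const _).deriv
  have dz : ∀ x y z, deriv (fun z => s x y z) z
      = Real.cosh (l₁ * x) * Real.cosh (l₂ * y) * (Real.cos (Λ * z) * Λ) := fun x y z => by
    simp only [hs]
    exact ((hsn Λ z).const_mul _).deriv
  have hL : Λ ^ 2 = l₁ ^ 2 + l₂ ^ 2 := by
    rw [hΛ, Real.sq_sqrt (by positivity)]
  have e1 : σ * Real.cosh (l₁ * a) = l₁ * Real.sinh (l₁ * a) := by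
    have := (Real.cosh_pos (l₁ * a)).ne'
    rw [hσ, Real.tanh_eq_sinh_div_cosh]; field_simp
  have e2 : σ * Real.cosh (l₂ * b) = l₂ * Real.sinh (l₂ * b) := by
    have := (Real.cosh_pos (l₂ * b)).ne'
    rw [hσb, Real.tanh_eq_sinh_div_cosh]; field_simp
  refine ⟨fun x y z => ?_, fun y _ z _ => ?_, fun x _ z _ => ?_, fun x _ y _ => ?_⟩
  · simp only [dx, dy, dz]
    rw [((((hS l₁ x).mul_const l₁).mul_const (Real.cosh (l₂ * y))).mul_const
        (Real.sin (Λ * z))).deriv,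
      ((((hS l₂ y).mul_const l₂).const_mul (Real.cosh (l₁ * x))).mul_const
        (Real.sin (Λ * z))).deriv,
      (((hcs Λ z).mul_const Λ).const_mul (Real.cosh (l₁ * x) * Real.cosh (l₂ * y))).deriv]
    linear_combination (-Real.cosh (l₁ * x) * Real.cosh (l₂ * y) * Real.sin (Λ * z)) * hL
  · rw [dx, dx, hs, hs, mul_neg, Real.sinh_neg, Real.cosh_neg]
    constructor
    · linear_combination (-Real.cosh (l₂ * y) * Real.sin (Λ * z)) * e1
    · linear_combination (Real.cosh (l₂ * y) * Real.sin (Λ * z)) * e1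
  · rw [dy, dy, hs, hs, mul_neg, Real.sinh_neg, Real.cosh_neg]
    constructor
    · linear_combination (-Real.cosh (l₁ * x) * Real.sin (Λ * z)) * e2
    · linear_combination (Real.cosh (l₁ * x) * Real.sin (Λ * z)) * e2
  · rw [dz, dz, hs, hs, mul_neg, Real.sin_neg, Real.cos_neg]
    constructor
    · linear_combination (-Real.cosh (l₁ * x) * Real.cosh (l₂ * y)) * hσc
    · linear_combination (-Real.cosh (l₁ * x) * Real.cosh (l₂ * y)) * hσc
end

section
/- The unique ν ∈ (0, π/2) satisfying tan ν = coth ν (i.e. sin ν · sinh ν = cos ν · cosh ν) satisfies 0.9375 < ν < 0.9376, and the corresponding eigenvalue σ = ν·tanh ν satisfies 0.6882 < σ < 0.6883. -/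
theorem aux_trig (x : ℝ) (h0 : 0 ≤ x) (h1 : x ≤ 1) :
    |Real.cos x - (1 - x^2/2 + x^4/24 - x^6/720 + x^8/40320)| ≤ x^10 * (11 / 36288000) ∧
    |Real.sin x - (x - x^3/6 + x^5/120 - x^7/5040 + x^9/362880)| ≤ x^10 * (11 / 36288000) := by
  have hn : ‖(x:ℂ) * Complex.I‖ = x := by simp [abs_of_nonneg h0]
  have h := Complex.exp_bound (x := (x:ℂ) * Complex.I) (by rw [hn]; exact h1) (n := 10) (by norm_num)
  rw [hn] at h
  have hc : x ^ 10 * (((10:ℕ).succ : ℝ) * (((10:ℕ).factorial * (10:ℕ) : ℝ))⁻¹) = x^10 * (11 / 36288000) := by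
    norm_num [Nat.factorial]
  rw [hc] at h
  have hs : ∑ m ∈ Finset.range 10, ((x:ℂ) * Complex.I)^m / (m.factorial : ℂ)
      = ((1 - x^2/2 + x^4/24 - x^6/720 + x^8/40320 : ℝ) : ℂ)
        + ((x - x^3/6 + x^5/120 - x^7/5040 + x^9/362880 : ℝ) : ℂ) * Complex.I := by
    have i2 : Complex.I^2 = -1 := Complex.I_sq
    have i3 : Complex.I^3 = -Complex.I := Complex.I_pow_three
    have i4 : Complex.I^4 = 1 := Complex.I_pow_four
    have i5 : Complex.I^5 = Complex.I := by rw [show 5 = 4+1 from rfl, pow_add, i4]; simp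
    have i6 : Complex.I^6 = -1 := by rw [show 6 = 4+2 from rfl, pow_add, i4]; simp
    have i7 : Complex.I^7 = -Complex.I := by rw [show 7 = 4+3 from rfl, pow_add, i4, i3]; simp
    have i8 : Complex.I^8 = 1 := by rw [show 8 = 4+4 from rfl, pow_add, i4]; simp
    have i9 : Complex.I^9 = Complex.I := by rw [show 9 = 8+1 from rfl, pow_add, i8]; simp
    simp only [Finset.sum_range_succ, Finset.sum_range_zero, mul_pow, i2, i3, i4, i5, i6, i7, i8, i9]
    norm_num [Nat.factorial]
    ring
  rw [hs, Complex.exp_mul_I, ← Complex.ofReal_cos, ← Complex.ofReal_sin] at h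
  constructor
  · refine le_trans ?_ h
    refine le_trans (le_of_eq ?_) (Complex.abs_re_le_norm _)
    simp only [Complex.sub_re, Complex.add_re, Complex.re_ofReal_mul, Complex.ofReal_re, Complex.I_re]
    congr 1; ring
  · refine le_trans ?_ h
    refine le_trans (le_of_eq ?_) (Complex.abs_im_le_norm _)
    simp only [Complex.sub_im, Complex.add_im, Complex.im_ofReal_mul, Complex.ofReal_im, Complex.I_im]
    congr 1; ring

theorem aux_exp (x : ℝ) (h1 : |x| ≤ 1) :
    |Real.exp x - (1 + x + x^2/2 + x^3/6 + x^4/24 + x^5/120 + x^6/720 + x^7/5040 + x^8/40320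
      + x^9/362880)| ≤ |x|^10 * (11 / 36288000) := by
  have h := Real.exp_bound h1 (n := 10) (by norm_num)
  simp only [Finset.sum_range_succ, Finset.sum_range_zero] at h
  norm_num [Nat.factorial] at h ⊢
  exact h

theorem aux_mono : StrictMonoOn
    (fun x : ℝ => Real.sin x * Real.sinh x - Real.cos x * Real.cosh x) (Set.Icc 0 (Real.pi/2)) := by
  apply strictMonoOn_of_deriv_pos (convex_Icc _ _)
  · fun_prop
  · intro x hx
    rw [interior_Icc] at hx
    have hd : HasDerivAt (fun x : ℝ => Real.sin x * Real.sinh x - Real.cos x * Real.cosh x)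
        (2 * Real.sin x * Real.cosh x) x := by
      have := ((Real.hasDerivAt_sin x).mul (Real.hasDerivAt_sinh x)).sub
        ((Real.hasDerivAt_cos x).mul (Real.hasDerivAt_cosh x))
      exact this.congr_deriv (by ring)
    rw [hd.deriv]
    have := Real.sin_pos_of_pos_of_lt_pi hx.1 (by linarith [hx.2, Real.pi_pos])
    have := Real.cosh_pos x
    positivity

theorem aux_lo : Real.sin 0.93752 * Real.sinh 0.93752 - Real.cos 0.93752 * Real.cosh 0.93752 < 0
    ∧ 0.6882 < 0.93752 * Real.tanh 0.93752 := by
  obtain ⟨hc, hs⟩ := aux_trig 0.93752 (by norm_num) (by norm_num)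
  have he := aux_exp 0.93752 (by norm_num [abs_le])
  have hm := aux_exp (-0.93752) (by norm_num [abs_le])
  rw [abs_neg] at hm
  rw [abs_of_pos (by norm_num : (0:ℝ) < 0.93752)] at he hm
  rw [abs_le] at hc hs he hm
  have hsl : Real.sin 0.93752 < 0.806094 := by norm_num at hs ⊢; linarith [hs.2]
  have hcl : 0.591788 < Real.cos 0.93752 := by norm_num at hc ⊢; linarith [hc.1]
  have h1 : Real.sinh 0.93752 < 1.081023 ∧ 1.081020 < Real.sinh 0.93752 := by
    rw [Real.sinh_eq]; norm_num at he hm ⊢; constructor <;> linarith [he.1, he.2, hm.1, hm.2]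
  have h2 : Real.cosh 0.93752 < 1.472621 ∧ 1.472618 < Real.cosh 0.93752 := by
    rw [Real.cosh_eq]; norm_num at he hm ⊢; constructor <;> linarith [he.1, he.2, hm.1, hm.2]
  constructor
  · have a := mul_lt_mul'' hsl h1.1 (Real.sin_nonneg_of_nonneg_of_le_pi (by norm_num) (by linarith [Real.pi_gt_three])) (by linarith [h1.2])
    have b := mul_lt_mul'' hcl h2.2 (by norm_num) (by norm_num)
    norm_num at a b ⊢
    linarith
  · rw [Real.tanh_eq_sinh_div_cosh, ← mul_div_assoc, lt_div_iff₀ (Real.cosh_pos _)]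
    linarith [h1.2, h2.1]

theorem aux_hi : 0 < Real.sin 0.93758 * Real.sinh 0.93758 - Real.cos 0.93758 * Real.cosh 0.93758
    ∧ 0.93758 * Real.tanh 0.93758 < 0.6883 := by
  obtain ⟨hc, hs⟩ := aux_trig 0.93758 (by norm_num) (by norm_num)
  have he := aux_exp 0.93758 (by norm_num [abs_le])
  have hm := aux_exp (-0.93758) (by norm_num [abs_le])
  rw [abs_neg] at hm
  rw [abs_of_pos (by norm_num : (0:ℝ) < 0.93758)] at he hm
  rw [abs_le] at hc hs he hm
  have hsl : 0.806127 < Real.sin 0.93758 := by norm_num at hs ⊢; linarith [hs.1]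
  have hcl : Real.cos 0.93758 < 0.591742 := by norm_num at hc ⊢; linarith [hc.2]
  have h1 : Real.sinh 0.93758 < 1.081112 ∧ 1.081108 < Real.sinh 0.93758 := by
    rw [Real.sinh_eq]; norm_num at he hm ⊢; constructor <;> linarith [he.1, he.2, hm.1, hm.2]
  have h2 : Real.cosh 0.93758 < 1.472686 ∧ 1.472682 < Real.cosh 0.93758 := by
    rw [Real.cosh_eq]; norm_num at he hm ⊢; constructor <;> linarith [he.1, he.2, hm.1, hm.2]
  constructor
  · have a := mul_lt_mul'' hsl h1.2 (by norm_num) (by norm_num)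
    have b := mul_lt_mul'' hcl h2.1 (Real.cos_nonneg_of_neg_pi_div_two_le_of_le (by linarith [Real.pi_gt_three]) (by linarith [Real.pi_gt_three])) (Real.cosh_pos _).le
    norm_num at a b ⊢
    linarith
  · rw [Real.tanh_eq_sinh_div_cosh, ← mul_div_assoc, div_lt_iff₀ (Real.cosh_pos _)]
    linarith [h1.1, h2.2]

theorem aux_tanh {a b : ℝ} (h : a < b) : Real.tanh a < Real.tanh b := by
  rw [Real.tanh_eq_sinh_div_cosh, Real.tanh_eq_sinh_div_cosh,
    div_lt_div_iff₀ (Real.cosh_pos _) (Real.cosh_pos _)]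
  have := Real.sinh_pos_iff.2 (sub_pos.2 h)
  rw [Real.sinh_sub] at this
  linarith

theorem stmt_18 :
    (∃! ν : ℝ, ν ∈ Set.Ioo 0 (Real.pi / 2) ∧
      Real.sin ν * Real.sinh ν = Real.cos ν * Real.cosh ν) ∧
    (∀ ν ∈ Set.Ioo 0 (Real.pi / 2),
      Real.sin ν * Real.sinh ν = Real.cos ν * Real.cosh ν →
      0.9375 < ν ∧ ν < 0.9376 ∧
      0.6882 < ν * Real.tanh ν ∧ ν * Real.tanh ν < 0.6883) := by
  have hp := Real.pi_gt_three
  have m1 : (0.93752 : ℝ) ∈ Set.Icc 0 (Real.pi / 2) := ⟨by norm_num, by linarith⟩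
  have m2 : (0.93758 : ℝ) ∈ Set.Icc 0 (Real.pi / 2) := ⟨by norm_num, by linarith⟩
  constructor
  · have hc : ContinuousOn (fun x : ℝ => Real.sin x * Real.sinh x - Real.cos x * Real.cosh x)
        (Set.Icc 0.93752 0.93758) := by fun_prop
    obtain ⟨ν, hν, h0⟩ := intermediate_value_Icc (by norm_num) hc ⟨aux_lo.1.le, aux_hi.1.le⟩
    have h0' : Real.sin ν * Real.sinh ν - Real.cos ν * Real.cosh ν = 0 := h0
    have hν0 : (0:ℝ) < ν := lt_of_lt_of_le (by norm_num) hν.1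
    refine ⟨ν, ⟨⟨hν0, by linarith [hν.2]⟩, by linarith⟩, ?_⟩
    rintro y ⟨hy, hy0⟩
    refine aux_mono.injOn ⟨hy.1.le, hy.2.le⟩ ⟨hν0.le, by linarith [hν.2]⟩ ?_
    change Real.sin y * Real.sinh y - Real.cos y * Real.cosh y
      = Real.sin ν * Real.sinh ν - Real.cos ν * Real.cosh ν
    linarith
  · intro ν hν h
    have m : ν ∈ Set.Icc 0 (Real.pi / 2) := ⟨hν.1.le, hν.2.le⟩
    have l1 : 0.93752 < ν := by
      refine (aux_mono.lt_iff_lt m1 m).1 ?_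
      change _ < Real.sin ν * Real.sinh ν - Real.cos ν * Real.cosh ν
      rw [h, sub_self]
      exact aux_lo.1
    have l2 : ν < 0.93758 := by
      refine (aux_mono.lt_iff_lt m m2).1 ?_
      change Real.sin ν * Real.sinh ν - Real.cos ν * Real.cosh ν < _
      rw [h, sub_self]
      exact aux_hi.1
    have t0 : 0 < Real.tanh 0.93752 := by simpa using aux_tanh (show (0:ℝ) < 0.93752 by norm_num)
    have t1 := aux_tanh l1
    have t2 := aux_tanh l2
    refine ⟨by linarith, by linarith, ?_, ?_⟩
    · exact aux_lo.2.trans (mul_lt_mul'' l1 t1 (by norm_num) t0.le)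
    · exact (mul_lt_mul'' l2 t2 hν.1.le (t0.trans t1).le).trans aux_hi.2
end
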